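/- arXiv:1611.05655 — 10 statements merged into one kernel-verified Lean document; each statement's English description precedes it below -/
import Mathlib

section
/- For all x', y' ∈ R^β, the binary dot product ψ(x')·ψ(y') ∈ 𝔽₂ equals 1 if and only if x'·y' ∈ {1, u}, where x'·y' = Σ_{j=1}^{β} x'_j y'_j ∈ R. -/
/-- The binary field `𝔽₂`. -/
abbrev F2 : Type := ZMod 2

/-- The ring `R = 𝔽₂[u] = 𝔽₂[X]/(X²)` of dual numbers over `𝔽₂`. -/
abbrev Ru : Type := DualNumber F2

/-- Coordinatewise extension `ψ : R^β → 𝔽₂^(2β)` of the Gray-like map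
`ψ(0)=(0,0), ψ(1)=(0,1), ψ(u)=(1,1), ψ(1+u)=(1,0)`. -/
def psiVec {β : ℕ} (x : Fin β → Ru) : Fin (2 * β) → F2 := fun k =>
  if k.val % 2 = 0 then (x ⟨k.val / 2, by have := k.isLt; omega⟩).snd
  else (x ⟨k.val / 2, by have := k.isLt; omega⟩).fst + (x ⟨k.val / 2, by have := k.isLt; omega⟩).snd

/-- The index set `Fin (2 * β)` as `β` consecutive pairs of coordinates. -/
def coordEquiv (β : ℕ) : Fin β × Fin 2 ≃ Fin (2 * β) :=
  finProdFinEquiv.trans (finCongr (mul_comm β 2))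

theorem psiVec_coordEquiv_zero {β : ℕ} (x : Fin β → Ru) (j : Fin β) :
    psiVec x (coordEquiv β (j, 0)) = (x j).snd := by
  simp [psiVec, coordEquiv]

theorem psiVec_coordEquiv_one {β : ℕ} (x : Fin β → Ru) (j : Fin β) :
    psiVec x (coordEquiv β (j, 1)) = (x j).fst + (x j).snd := by
  have h : (1 + 2 * (j : ℕ)) / 2 = j := by omega
  simp [psiVec, coordEquiv, h]

/-- The binary dot product of Gray images is the sum of the two components of the product in `R`. -/
theorem sum_psiVec_mul_psiVec {β : ℕ} (x y : Fin β → Ru) :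
    ∑ k, psiVec x k * psiVec y k = (∑ j, x j * y j).fst + (∑ j, x j * y j).snd := by
  rw [← (coordEquiv β).sum_comp, Fintype.sum_prod_type, TrivSqZeroExt.fst_sum,
    TrivSqZeroExt.snd_sum, ← Finset.sum_add_distrib]
  refine Finset.sum_congr rfl fun j _ => ?_
  rw [Fin.sum_univ_two, psiVec_coordEquiv_zero, psiVec_coordEquiv_zero, psiVec_coordEquiv_one,
    psiVec_coordEquiv_one, DualNumber.snd_mul, TrivSqZeroExt.fst_mul]
  linear_combination CharTwo.add_self_eq_zero ((x j).snd * (y j).snd)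

theorem fst_add_snd_eq_one_iff (z : Ru) :
    z.fst + z.snd = 1 ↔ z ∈ ({1, DualNumber.eps} : Set Ru) := by
  have key : ∀ a b : F2, a + b = 1 ↔ (a = 1 ∧ b = 0) ∨ (a = 0 ∧ b = 1) := by decide
  simp [TrivSqZeroExt.ext_iff, key]

/-- For all `x', y' ∈ R^β`, the binary dot product `ψ(x')·ψ(y')` equals `1` if and only if
`x'·y' ∈ {1, u}`, where `x'·y' = Σⱼ x'ⱼ y'ⱼ ∈ R`. -/
theorem psi_dotProduct_eq_one_iff (β : ℕ) (x' y' : Fin β → Ru) :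
    (∑ k, psiVec x' k * psiVec y' k) = 1 ↔
    (∑ j, x' j * y' j) ∈ ({1, DualNumber.eps} : Set Ru) := by
  rw [sum_psiVec_mul_psiVec, fst_add_snd_eq_one_iff]
end

section
/- Let 𝒞 ⊆ 𝔽₂^α × R^β be a ℤ₂ℤ₂[u]-additive code and let C = Ψ(𝒞) ⊆ 𝔽₂^(α+2β). Then Ψ(𝒞^⊥) = C^⊥, where 𝒞^⊥ = {v ∈ 𝔽₂^α × R^β : x·v = 0 for all x ∈ 𝒞} is the dual with respect to the R-valued inner product and C^⊥ is the dual with respect to the standard binary dot product. -/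
/-- `R` acts on `𝔽₂` through the projection `π : R → 𝔽₂`, `π(u) = 0`. -/
noncomputable instance : Module Ru F2 :=
  Module.compHom F2 (TrivSqZeroExt.fstHom F2 F2 F2).toRingHom

/-- The map `Ψ : 𝔽₂^α × R^β → 𝔽₂^(α+2β)`, `Ψ(x | x') = (x | ψ(x'))`. -/
def Psi {α β : ℕ} (p : (Fin α → F2) × (Fin β → Ru)) : Fin (α + 2 * β) → F2 :=
  Fin.append p.1 (psiVec p.2)

/-- The `R`-valued inner product `x·y = u·ι(Σᵢ xᵢyᵢ) + Σⱼ x'ⱼ y'ⱼ ∈ R` on `𝔽₂^α × R^β`,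
where `ι : 𝔽₂ → R` is the inclusion. -/
noncomputable def innR {α β : ℕ} (x y : (Fin α → F2) × (Fin β → Ru)) : Ru :=
  DualNumber.eps * algebraMap F2 Ru (∑ i, x.1 i * y.1 i) + ∑ j, x.2 j * y.2 j

theorem psiVec_even {β : ℕ} (x : Fin β → Ru) (j : Fin β) (h : 2 * j.val < 2 * β) :
    psiVec x ⟨2 * j.val, h⟩ = (x j).snd := by
  simp [psiVec]

theorem psiVec_odd {β : ℕ} (x : Fin β → Ru) (j : Fin β) (h : 2 * j.val + 1 < 2 * β) :
    psiVec x ⟨2 * j.val + 1, h⟩ = (x j).fst + (x j).snd := by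
  have h₂ : (2 * j.val + 1) / 2 = j.val := by omega
  simp [psiVec, h₂]

theorem sum_fin_two_mul {M : Type*} [AddCommMonoid M] {β : ℕ} (f : Fin (2 * β) → M) :
    ∑ k, f k = ∑ j : Fin β, (f ⟨2 * j.val, by omega⟩ + f ⟨2 * j.val + 1, by omega⟩) := by
  rw [← (finProdFinEquiv.trans (finCongr (mul_comm β 2))).sum_comp f, Fintype.sum_prod_type]
  refine Finset.sum_congr rfl fun j _ => ?_
  rw [Fin.sum_univ_two]
  congr 2 <;> ext <;> simp [add_comm]

theorem Psi_surjective {α β : ℕ} :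
    Function.Surjective (Psi : (Fin α → F2) × (Fin β → Ru) → Fin (α + 2 * β) → F2) := by
  intro w
  refine ⟨(fun i => w (Fin.castAdd _ i), fun j =>
    ((w (Fin.natAdd α ⟨2 * j.val + 1, by omega⟩) - w (Fin.natAdd α ⟨2 * j.val, by omega⟩),
      w (Fin.natAdd α ⟨2 * j.val, by omega⟩)) : F2 × F2)), ?_⟩
  funext k
  refine Fin.addCases (fun i => ?_) (fun k => ?_) k
  · simp [Psi]
  · rw [Psi, Fin.append_right]
    obtain ⟨k, hk⟩ := k
    obtain ⟨j, rfl | rfl⟩ := Nat.even_or_odd' k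
    · exact psiVec_even _ ⟨j, by omega⟩ hk
    · exact (psiVec_odd _ ⟨j, by omega⟩ hk).trans (sub_add_cancel _ _)

theorem innR_fst {α β : ℕ} (x y : (Fin α → F2) × (Fin β → Ru)) :
    (innR x y).fst = ∑ j, (x.2 j).fst * (y.2 j).fst := by
  simp [innR, TrivSqZeroExt.fst_sum]

theorem innR_snd {α β : ℕ} (x y : (Fin α → F2) × (Fin β → Ru)) :
    (innR x y).snd = ∑ i, x.1 i * y.1 i +
      ∑ j, ((x.2 j).fst * (y.2 j).snd + (x.2 j).snd * (y.2 j).fst) := by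
  rw [innR, TrivSqZeroExt.snd_add, TrivSqZeroExt.snd_sum, TrivSqZeroExt.algebraMap_eq_inl]
  simp [mul_comm]

/-- The binary dot product of Gray images is the sum of the two coordinates of the
`R`-valued inner product. -/
theorem Psi_dotProduct_Psi {α β : ℕ} (x y : (Fin α → F2) × (Fin β → Ru)) :
    ∑ i, Psi y i * Psi x i = (innR x y).fst + (innR x y).snd := by
  rw [Fin.sum_univ_add, innR_fst, innR_snd, add_left_comm, ← Finset.sum_add_distrib,
    sum_fin_two_mul]
  simp only [Psi, Fin.append_left, Fin.append_right, psiVec_even, psiVec_odd]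
  congr 1
  · exact Finset.sum_congr rfl fun i _ => mul_comm _ _
  · refine Finset.sum_congr rfl fun j _ => ?_
    linear_combination (x.2 j).snd * (y.2 j).snd * CharTwo.two_eq_zero (R := F2)

theorem innR_smul {α β : ℕ} (r : Ru) (x y : (Fin α → F2) × (Fin β → Ru)) :
    innR (r • x) y = r * innR x y := by
  have hr (i : Fin α) : (r • x).1 i = r.fst * x.1 i := rfl
  ext
  · simp [innR_fst, Finset.mul_sum, mul_assoc]
  · simp only [innR_snd, innR_fst, hr, Prod.smul_snd, Pi.smul_apply, smul_eq_mul,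
      TrivSqZeroExt.fst_mul, TrivSqZeroExt.snd_mul, MulOpposite.smul_eq_mul_unop,
      MulOpposite.unop_op, mul_add, Finset.mul_sum, add_assoc]
    congr 1
    · exact Finset.sum_congr rfl fun i _ => by ring
    · rw [← Finset.sum_add_distrib]
      exact Finset.sum_congr rfl fun j _ => by ring

/-- Let `𝒞 ⊆ 𝔽₂^α × R^β` be a `ℤ₂ℤ₂[u]`-additive code and `C = Ψ(𝒞)`. Then
`Ψ(𝒞^⊥) = C^⊥`, where `𝒞^⊥` is the dual with respect to the `R`-valued inner product and
`C^⊥` is the dual with respect to the standard binary dot product. -/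
theorem psi_dual_eq_binary_dual (α β : ℕ)
    (𝒞 : Submodule Ru ((Fin α → F2) × (Fin β → Ru))) :
    Psi '' {v : (Fin α → F2) × (Fin β → Ru) | ∀ x ∈ 𝒞, innR x v = 0} =
    {w : Fin (α + 2 * β) → F2 |
      ∀ c ∈ Psi '' (𝒞 : Set ((Fin α → F2) × (Fin β → Ru))), (∑ i, w i * c i) = 0} := by
  ext w
  obtain ⟨v, rfl⟩ := Psi_surjective w
  simp only [Set.mem_image, Set.mem_ofPred_eq, SetLike.mem_coe, forall_exists_index, and_imp,
    forall_apply_eq_imp_iff₂]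
  constructor
  · rintro ⟨v', hv', hvv'⟩ x hx
    rw [← hvv', Psi_dotProduct_Psi, hv' x hx]
    simp
  · refine fun h => ⟨v, fun x hx => ?_, rfl⟩
    have hsum := h x hx
    have hfst := h _ (𝒞.smul_mem (DualNumber.eps : Ru) hx)
    rw [Psi_dotProduct_Psi] at hsum hfst
    rw [innR_smul] at hfst
    simp only [TrivSqZeroExt.fst_mul, TrivSqZeroExt.snd_mul, DualNumber.fst_eps,
      DualNumber.snd_eps, zero_mul, zero_smul, zero_add, MulOpposite.smul_eq_mul_unop,
      MulOpposite.unop_op, one_mul] at hfst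
    rw [hfst, zero_add] at hsum
    exact TrivSqZeroExt.ext hfst hsum
end

section
/- Let 𝒞 ⊆ 𝔽₂^α × R^β be a ℤ₂ℤ₂[u]-additive code with β > 0 and let C = Ψ(𝒞). Let σ be the permutation of the α+2β coordinates that fixes the first α coordinates and transposes coordinates α+2i−1 and α+2i for each i = 1, …, β. Then σ(Ψ(x)) = Ψ((1+u)·x) for every x ∈ 𝒞; in particular, σ is an involution in Aut(C) fixing exactly α coordinates. -/
/-- The permutation of the `α + 2β` coordinates fixing the first `α` coordinates and
transposing the coordinates of each of the `β` pairs coming from the `R`-coordinates. -/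
def sigmaFun (α β : ℕ) (k : Fin (α + 2 * β)) : Fin (α + 2 * β) :=
  if h1 : k.val < α then k
  else if h2 : (k.val - α) % 2 = 0 then ⟨k.val + 1, by have := k.isLt; omega⟩
  else ⟨k.val - 1, by have := k.isLt; omega⟩

lemma sigmaFun_involutive (α β : ℕ) : Function.Involutive (sigmaFun α β) := by
  intro k
  have hk := k.isLt
  by_cases h1 : k.val < α
  · simp [sigmaFun, h1]
  · by_cases h2 : (k.val - α) % 2 = 0
    · have e1 : sigmaFun α β k = ⟨k.val + 1, by omega⟩ := by simp [sigmaFun, h1, h2]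
      rw [e1]
      have h1' : ¬ (k.val + 1 < α) := by omega
      have h2' : ¬ ((k.val + 1 - α) % 2 = 0) := by omega
      simp only [sigmaFun, h1', h2', dif_neg]
      apply Fin.ext
      simp
    · have e1 : sigmaFun α β k = ⟨k.val - 1, by omega⟩ := by simp [sigmaFun, h1, h2]
      rw [e1]
      have h1' : ¬ (k.val - 1 < α) := by omega
      have h2' : (k.val - 1 - α) % 2 = 0 := by omega
      simp only [sigmaFun, h1', h2', dif_neg, dif_pos]
      apply Fin.ext
      simp
      omega

/-- The coordinate permutation `σ` transposing coordinates `α+2i−1` and `α+2i` for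
`i = 1, …, β` and fixing the first `α` coordinates. -/
def sigmaPerm (α β : ℕ) : Equiv.Perm (Fin (α + 2 * β)) :=
  (sigmaFun_involutive α β).toPerm

lemma sigmaFun_of_lt {α β : ℕ} {k : Fin (α + 2 * β)} (h : k.val < α) : sigmaFun α β k = k :=
  dif_pos h

lemma sigmaFun_eq_self_iff {α β : ℕ} (k : Fin (α + 2 * β)) : sigmaFun α β k = k ↔ k.val < α := by
  refine ⟨fun h => ?_, sigmaFun_of_lt⟩
  by_contra h1
  have hv := congrArg Fin.val h
  unfold sigmaFun at hv
  split_ifs at hv <;> simp at hv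
  omega

lemma Psi_apply_of_lt {α β : ℕ} (p : (Fin α → F2) × (Fin β → Ru)) {k : Fin (α + 2 * β)}
    (h : k.val < α) : Psi p k = p.1 ⟨k, h⟩ :=
  Fin.append_left p.1 (psiVec p.2) ⟨k, h⟩

lemma Psi_apply_even {α β : ℕ} (p : (Fin α → F2) × (Fin β → Ru)) (i : Fin β)
    {k : Fin (α + 2 * β)} (h : k.val = α + 2 * i) : Psi p k = (p.2 i).snd := by
  have hk : k = Fin.natAdd α ⟨2 * i, by omega⟩ := Fin.ext h
  rw [hk, Psi, Fin.append_right]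
  simp [psiVec]

lemma Psi_apply_odd {α β : ℕ} (p : (Fin α → F2) × (Fin β → Ru)) (i : Fin β)
    {k : Fin (α + 2 * β)} (h : k.val = α + 2 * i + 1) :
    Psi p k = (p.2 i).fst + (p.2 i).snd := by
  have hk : k = Fin.natAdd α ⟨2 * i + 1, by omega⟩ := Fin.ext h
  rw [hk, Psi, Fin.append_right]
  have h2 : (2 * i.val + 1) / 2 = i := by omega
  simp [psiVec, h2]

lemma one_add_eps_smul_fst {α β : ℕ} (p : (Fin α → F2) × (Fin β → Ru)) :
    (((1 : Ru) + DualNumber.eps) • p).1 = p.1 := by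
  funext i
  change (1 + 0 : F2) * p.1 i = p.1 i
  simp

lemma one_add_eps_smul_snd {α β : ℕ} (p : (Fin α → F2) × (Fin β → Ru)) (i : Fin β) :
    (((1 : Ru) + DualNumber.eps) • p).2 i = (1 + DualNumber.eps) * p.2 i :=
  rfl

/-- Swapping the two coordinates of each pair is multiplication by `1 + u`. -/
lemma Psi_sigmaFun {α β : ℕ} (p : (Fin α → F2) × (Fin β → Ru)) (k : Fin (α + 2 * β)) :
    Psi p (sigmaFun α β k) = Psi (((1 : Ru) + DualNumber.eps) • p) k := by
  have hk := k.isLt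
  by_cases h1 : k.val < α
  · rw [sigmaFun_of_lt h1, Psi_apply_of_lt _ h1, Psi_apply_of_lt _ h1, one_add_eps_smul_fst]
  · let i : Fin β := ⟨(k.val - α) / 2, by omega⟩
    by_cases h2 : (k.val - α) % 2 = 0
    · have hk0 : k.val = α + 2 * i := by simp only [i]; omega
      have hs : (sigmaFun α β k).val = α + 2 * i + 1 := by
        simp only [sigmaFun, h1, h2, dite_true, dite_false]; omega
      rw [Psi_apply_odd _ i hs, Psi_apply_even _ i hk0, one_add_eps_smul_snd]
      simp [add_comm]
    · have hk1 : k.val = α + 2 * i + 1 := by simp only [i]; omega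
      have hs : (sigmaFun α β k).val = α + 2 * i := by
        simp only [sigmaFun, h1, h2, dite_false]; omega
      rw [Psi_apply_even _ i hs, Psi_apply_odd _ i hk1, one_add_eps_smul_snd]
      simp [add_left_comm (p.2 i).fst, CharTwo.add_self_eq_zero]

/-- Let `𝒞 ⊆ 𝔽₂^α × R^β` be a `ℤ₂ℤ₂[u]`-additive code with `β > 0` and `C = Ψ(𝒞)`.
Then `σ(Ψ(x)) = Ψ((1+u)·x)` for every `x ∈ 𝒞`; in particular, `σ` is an involution in
`Aut(C)` fixing exactly `α` coordinates. -/
theorem sigma_image_psi (α β : ℕ) (hβ : 0 < β)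
    (𝒞 : Submodule Ru ((Fin α → F2) × (Fin β → Ru))) :
    (∀ x ∈ 𝒞, (fun i => Psi x ((sigmaPerm α β)⁻¹ i)) =
        Psi (((1 : Ru) + DualNumber.eps) • x)) ∧
    (∀ i, sigmaPerm α β (sigmaPerm α β i) = i) ∧
    sigmaPerm α β ≠ Equiv.refl (Fin (α + 2 * β)) ∧
    (Finset.univ.filter fun i => sigmaPerm α β i = i).card = α ∧
    (fun c : Fin (α + 2 * β) → F2 => fun i => c ((sigmaPerm α β)⁻¹ i)) ''
        (Psi '' (𝒞 : Set ((Fin α → F2) × (Fin β → Ru)))) =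
      Psi '' (𝒞 : Set ((Fin α → F2) × (Fin β → Ru))) := by
  have hσ : ∀ x : (Fin α → F2) × (Fin β → Ru),
      (fun i => Psi x ((sigmaPerm α β)⁻¹ i)) = Psi (((1 : Ru) + DualNumber.eps) • x) :=
    fun x => funext (Psi_sigmaFun x)
  have hinv : ∀ i, sigmaPerm α β (sigmaPerm α β i) = i := sigmaFun_involutive α β
  have hfix : ∀ i, sigmaPerm α β i = i ↔ i.val < α := sigmaFun_eq_self_iff
  refine ⟨fun x _ => hσ x, hinv, fun h => ?_, ?_, ?_⟩
  · have := (hfix ⟨α, by omega⟩).1 (by rw [h]; rfl)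
    simp at this
  · simp only [hfix]
    rw [Fin.card_filter_val_lt]
    omega
  · apply Set.Subset.antisymm
    · rintro _ ⟨_, ⟨x, hx, rfl⟩, rfl⟩
      exact ⟨_, 𝒞.smul_mem _ hx, (hσ x).symm⟩
    · rintro _ ⟨x, hx, rfl⟩
      refine ⟨_, ⟨_, 𝒞.smul_mem ((1 : Ru) + DualNumber.eps) hx, rfl⟩, ?_⟩
      rw [← hσ x]
      exact funext fun i => congrArg (Psi x) (hinv i)
end

section
/- Let C ⊆ 𝔽₂^n be an 𝔽₂-linear code and suppose σ ∈ Aut(C) is an involution (σ² = id, σ ≠ id) fixing exactly α coordinates; set β = (n − α)/2. Then there exist a permutation ρ of the n coordinates and a ℤ₂ℤ₂[u]-additive code 𝒞 ⊆ 𝔽₂^α × R^β such that ρ·C = Ψ(𝒞). -/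
/-- The first coordinate of the `k`-th pair of `Fin (2 * β)`. -/
def pairFst {β : ℕ} (k : Fin β) : Fin (2 * β) := ⟨2 * k, by omega⟩

/-- The second coordinate of the `k`-th pair of `Fin (2 * β)`. -/
def pairSnd {β : ℕ} (k : Fin β) : Fin (2 * β) := ⟨2 * k + 1, by omega⟩

theorem exists_eq_pairFst_or_pairSnd {β : ℕ} (j : Fin (2 * β)) :
    ∃ k, j = pairFst k ∨ j = pairSnd k :=
  ⟨⟨j / 2, by omega⟩, by simp only [pairFst, pairSnd, Fin.ext_iff]; omega⟩

theorem psiVec_pairFst {β : ℕ} (x : Fin β → Ru) (k : Fin β) :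
    psiVec x (pairFst k) = (x k).snd := by
  simp [psiVec, pairFst]

theorem psiVec_pairSnd {β : ℕ} (x : Fin β → Ru) (k : Fin β) :
    psiVec x (pairSnd k) = (x k).fst + (x k).snd := by
  have h : (2 * (k : ℕ) + 1) / 2 = k := by omega
  simp [psiVec, pairSnd, h, Nat.add_mod]

/-- Every coordinate of `Fin (α + 2 * β)` is one of the first `α` or belongs to a pair. -/
theorem forall_coordinate {α β : ℕ} {P : Fin (α + 2 * β) → Prop}
    (hl : ∀ i, P (Fin.castAdd (2 * β) i)) (h₁ : ∀ k, P (Fin.natAdd α (pairFst k)))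
    (h₂ : ∀ k, P (Fin.natAdd α (pairSnd k))) (j : Fin (α + 2 * β)) : P j := by
  induction j using Fin.addCases with
  | left i => exact hl i
  | right j =>
    obtain ⟨k, rfl | rfl⟩ := exists_eq_pairFst_or_pairSnd j
    exacts [h₁ k, h₂ k]

section Psi

variable {α β : ℕ} (p q : (Fin α → F2) × (Fin β → Ru))

theorem Psi_castAdd (i : Fin α) : Psi p (Fin.castAdd (2 * β) i) = p.1 i := by
  simp [Psi]

theorem Psi_pairFst (k : Fin β) : Psi p (Fin.natAdd α (pairFst k)) = (p.2 k).snd := by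
  simp [Psi, psiVec_pairFst]

theorem Psi_pairSnd (k : Fin β) :
    Psi p (Fin.natAdd α (pairSnd k)) = (p.2 k).fst + (p.2 k).snd := by
  simp [Psi, psiVec_pairSnd]

theorem Psi_add : Psi (p + q) = Psi p + Psi q := by
  funext j
  induction j using forall_coordinate with
  | hl i => simp [Psi_castAdd]
  | h₁ k => simp [Psi_pairFst]
  | h₂ k => simp [Psi_pairSnd]; ring

theorem Psi_zero : Psi (0 : (Fin α → F2) × (Fin β → Ru)) = 0 := by
  funext j
  induction j using forall_coordinate with
  | hl i => simp [Psi_castAdd]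
  | h₁ k => simp [Psi_pairFst]
  | h₂ k => simp [Psi_pairSnd]

theorem Psi_surjective_s9 : Function.Surjective (Psi (α := α) (β := β)) := fun w => by
  refine ⟨(fun i => w (Fin.castAdd _ i), fun k =>
    (w (Fin.natAdd α (pairFst k)) + w (Fin.natAdd α (pairSnd k)),
      w (Fin.natAdd α (pairFst k)))), ?_⟩
  funext j
  induction j using forall_coordinate with
  | hl i => simp [Psi_castAdd]
  | h₁ k => rw [Psi_pairFst]; rfl
  | h₂ k =>
    rw [Psi_pairSnd]
    change w _ + w _ + w _ = w _
    rw [add_right_comm, CharTwo.add_self_eq_zero, zero_add]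

/-- Multiplication by `u` corresponds under `Psi` to `w ↦ w + w ∘ τ`, where `τ` swaps
the coordinates in each pair. -/
theorem Psi_smul (r : Ru) (τ : Fin (α + 2 * β) → Fin (α + 2 * β))
    (hl : ∀ i, τ (Fin.castAdd _ i) = Fin.castAdd _ i)
    (h₁ : ∀ k, τ (Fin.natAdd α (pairFst k)) = Fin.natAdd α (pairSnd k))
    (h₂ : ∀ k, τ (Fin.natAdd α (pairSnd k)) = Fin.natAdd α (pairFst k)) :
    Psi (r • p) = r.fst • Psi p + r.snd • (Psi p + Psi p ∘ τ) := by
  have smul_fst_apply (i : Fin α) : (r • p).1 i = r.fst * p.1 i := rfl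
  have smul_snd_apply (k : Fin β) : (r • p).2 k = r * p.2 k := rfl
  funext j
  induction j using forall_coordinate with
  | hl i =>
    simp [Psi_castAdd, hl, smul_fst_apply, CharTwo.add_self_eq_zero]
  | h₁ k =>
    simp only [Psi_pairFst, Psi_pairSnd, smul_snd_apply, Pi.add_apply, Pi.smul_apply,
      Function.comp_apply, h₁, TrivSqZeroExt.snd_mul, smul_eq_mul, MulOpposite.smul_eq_mul_unop,
      MulOpposite.unop_op]
    linear_combination -r.snd * CharTwo.add_self_eq_zero (p.2 k).snd
  | h₂ k =>
    simp only [Psi_pairFst, Psi_pairSnd, smul_snd_apply, Pi.add_apply, Pi.smul_apply,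
      Function.comp_apply, h₂, TrivSqZeroExt.snd_mul, TrivSqZeroExt.fst_mul, smul_eq_mul,
      MulOpposite.smul_eq_mul_unop, MulOpposite.unop_op]
    linear_combination -r.snd * CharTwo.add_self_eq_zero (p.2 k).snd

end Psi

/-- The coordinates can be listed with the fixed points of an involution first, followed by its
two-element orbits. -/
theorem exists_coordinates_of_involutive {n α : ℕ} (σ : Equiv.Perm (Fin n))
    (hσ : ∀ i, σ (σ i) = i) (hfix : (Finset.univ.filter fun i => σ i = i).card = α) :
    ∃ (β : ℕ) (_ : n = α + 2 * β) (e : Fin (α + 2 * β) ≃ Fin n),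
      (∀ i, σ (e (Fin.castAdd _ i)) = e (Fin.castAdd _ i)) ∧
      ∀ k, σ (e (Fin.natAdd α (pairFst k))) = e (Fin.natAdd α (pairSnd k)) := by
  set F := Finset.univ.filter fun i => σ i = i with hF
  set L := Finset.univ.filter fun i => i < σ i with hL
  set U := Finset.univ.filter fun i => σ i < i with hU
  have hLU : L.card = U.card := by
    refine Finset.card_bij' (fun i _ => σ i) (fun i _ => σ i) ?_ ?_ ?_ ?_ <;> simp [hL, hU, hσ]
  have hn : n = α + 2 * L.card := by
    have h₁ : Disjoint F L := Finset.disjoint_filter.2 fun i _ h h' => by omega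
    have h₂ : Disjoint (F ∪ L) U := by
      rw [Finset.disjoint_left]
      simp only [hF, hL, hU, Finset.mem_union, Finset.mem_filter, Finset.mem_univ, true_and]
      intro i h h'
      omega
    have h₃ : F ∪ L ∪ U = Finset.univ := by
      ext i
      simp only [hF, hL, hU, Finset.mem_union, Finset.mem_filter, Finset.mem_univ, true_and,
        iff_true]
      omega
    have h₄ := Finset.card_union_of_disjoint h₂
    rw [h₃, Finset.card_union_of_disjoint h₁, Finset.card_univ, Fintype.card_fin] at h₄
    omega
  let f := (F.equivFinOfCardEq hfix).symm
  let g := L.equivFin.symm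
  let e : Fin (α + 2 * L.card) → Fin n := Fin.append (fun i => (f i : Fin n)) fun j =>
    if j.val % 2 = 0 then (g ⟨j / 2, by omega⟩ : Fin n) else σ (g ⟨j / 2, by omega⟩)
  have el (i) : e (Fin.castAdd _ i) = f i := by simp [e]
  have e₁ (k) : e (Fin.natAdd α (pairFst k)) = g k := by
    simp only [e, Fin.append_right]
    simp [pairFst]
  have e₂ (k) : e (Fin.natAdd α (pairSnd k)) = σ (g k) := by
    have h : (2 * (k : ℕ) + 1) / 2 = k := by omega
    simp only [e, Fin.append_right]
    simp [pairSnd, h, Nat.add_mod]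
  have hsurj : Function.Surjective e := fun i => by
    rcases lt_trichotomy i (σ i) with h | h | h
    · exact ⟨_, (e₁ (g.symm ⟨i, by simpa [hL] using h⟩)).trans (by simp)⟩
    · exact ⟨_, (el (f.symm ⟨i, by simpa [hF] using h.symm⟩)).trans (by simp)⟩
    · exact ⟨_, (e₂ (g.symm ⟨σ i, by simpa [hL, hσ] using h⟩)).trans (by simp [hσ])⟩
  refine ⟨L.card, hn, Equiv.ofBijective e ((Fintype.bijective_iff_surjective_and_card e).2
    ⟨hsurj, by simp [← hn]⟩), fun i => ?_, fun k => ?_⟩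
  · simpa [el, hF] using (Finset.mem_filter.1 (f i).2).2
  · simp [e₁, e₂]

/-- Let `C ⊆ 𝔽₂^n` be an `𝔽₂`-linear code and suppose `σ ∈ Aut(C)` is an involution
(`σ² = id`, `σ ≠ id`) fixing exactly `α` coordinates; set `β = (n − α)/2` (so
`n = α + 2β`). Then there exist a permutation `ρ` of the `n` coordinates and a
`ℤ₂ℤ₂[u]`-additive code `𝒞 ⊆ 𝔽₂^α × R^β` such that `ρ·C = Ψ(𝒞)` (up to the canonical
identification of `𝔽₂^n` with `𝔽₂^(α+2β)`). -/
theorem z2z2u_structure_of_involution (n α : ℕ) (C : Submodule F2 (Fin n → F2))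
    (σ : Equiv.Perm (Fin n))
    (hσ2 : ∀ i, σ (σ i) = i)
    (hσne : σ ≠ Equiv.refl (Fin n))
    (hAut : (fun c : Fin n → F2 => c ∘ ⇑σ⁻¹) '' (C : Set (Fin n → F2)) = C)
    (hfix : (Finset.univ.filter fun i => σ i = i).card = α) :
    ∃ (β : ℕ) (h : n = α + 2 * β) (ρ : Equiv.Perm (Fin n))
      (𝒞 : Submodule Ru ((Fin α → F2) × (Fin β → Ru))),
      (fun c : Fin n → F2 => c ∘ ⇑ρ⁻¹) '' (C : Set (Fin n → F2)) =
        (fun p => Psi p ∘ Fin.cast h) '' (𝒞 : Set ((Fin α → F2) × (Fin β → Ru))) := by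
  obtain ⟨β, h, e, hl, h₁⟩ := exists_coordinates_of_involutive σ hσ2 hfix
  have hσC : ∀ c ∈ C, c ∘ σ ∈ C := fun c hc => by
    obtain ⟨d, hd, rfl⟩ := hAut.symm.subset hc
    have hd' : (d ∘ ⇑σ⁻¹) ∘ σ = d := funext fun i => by simp
    exact hd'.symm ▸ hd
  let 𝒞 : Submodule Ru ((Fin α → F2) × (Fin β → Ru)) :=
    { carrier := {p | Psi p ∘ e.symm ∈ C}
      add_mem' := fun {p q} hp hq => by
        rw [Set.mem_ofPred_eq, Psi_add]
        exact C.add_mem hp hq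
      zero_mem' := by
        rw [Set.mem_ofPred_eq, Psi_zero]
        exact C.zero_mem
      smul_mem' := fun r p hp => by
        have hτ := Psi_smul p r (fun j => e.symm (σ (e j))) (by simp [hl]) (by simp [h₁])
          (by simp [← h₁, hσ2])
        have hcomp : Psi (r • p) ∘ e.symm =
            r.fst • (Psi p ∘ e.symm) + r.snd • (Psi p ∘ e.symm + (Psi p ∘ e.symm) ∘ σ) := by
          rw [hτ]
          funext i
          simp
        rw [Set.mem_ofPred_eq, hcomp]
        exact C.add_mem (C.smul_mem _ hp) (C.smul_mem _ (C.add_mem hp (hσC _ hp))) }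
  refine ⟨β, h, ((finCongr h).trans e).symm, 𝒞, ?_⟩
  ext w
  constructor
  · rintro ⟨c, hc, rfl⟩
    obtain ⟨p, hp⟩ := Psi_surjective_s9 (c ∘ e)
    refine ⟨p, ?_, ?_⟩
    · change Psi p ∘ e.symm ∈ C
      rw [hp]
      simpa [Function.comp_assoc] using hc
    · funext i
      simp [hp, Equiv.Perm.inv_def]
  · rintro ⟨p, hp, rfl⟩
    refine ⟨Psi p ∘ e.symm, hp, ?_⟩
    funext i
    simp [Equiv.Perm.inv_def]
end

section
/- Let 𝒞 ⊆ 𝔽₂^α × R^β be a ℤ₂ℤ₂[u]-additive code and C = Ψ(𝒞). Then the extended code C' = {(Σ_{i=1}^{α+2β} c_i, c) : c ∈ C} ⊆ 𝔽₂^(α+2β+1), obtained by appending an overall parity-check bit (placed among the binary coordinates), equals Ψ(𝒞') for a ℤ₂ℤ₂[u]-additive code 𝒞' ⊆ 𝔽₂^(α+1) × R^β, namely 𝒞' = {((Σ_i Ψ(x)_i, x₁, …, x_α) | x') : (x | x') ∈ 𝒞}. -/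
theorem sum_psiVec {β : ℕ} (x : Fin β → Ru) : ∑ k, psiVec x k = ∑ j, (x j).fst := by
  rw [← (finProdFinEquiv.trans (finCongr (Nat.mul_comm β 2))).sum_comp, Fintype.sum_prod_type]
  refine Finset.sum_congr rfl fun j _ => ?_
  have h : (1 + 2 * (j : ℕ)) / 2 = j := by omega
  simp [psiVec, Fin.sum_univ_two, finProdFinEquiv, h, add_left_comm, CharTwo.add_self_eq_zero]

theorem sum_Psi {α β : ℕ} (x : (Fin α → F2) × (Fin β → Ru)) :
    ∑ i, Psi x i = ∑ i, x.1 i + ∑ j, (x.2 j).fst := by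
  simp [Psi, Fin.sum_univ_add, sum_psiVec]

theorem Ru_smul_F2 (r : Ru) (a : F2) : r • a = r.fst * a := rfl

/-- The map prepending the parity bit of the Gray-like image, as an `R`-linear map. -/
noncomputable def parityExtend (α β : ℕ) :
    (Fin α → F2) × (Fin β → Ru) →ₗ[Ru] (Fin (α + 1) → F2) × (Fin β → Ru) where
  toFun x := ((Fin.cons (∑ i, Psi x i) x.1 : Fin (α + 1) → F2), x.2)
  map_add' x y := by
    refine Prod.ext (funext fun i => ?_) rfl
    refine Fin.cases ?_ (fun i => ?_) i
    · simp only [sum_Psi, Prod.fst_add, Prod.snd_add, Pi.add_apply, Fin.cons_zero,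
        TrivSqZeroExt.fst_add, Finset.sum_add_distrib]
      ring
    · simp
  map_smul' r x := by
    refine Prod.ext (funext fun i => ?_) rfl
    refine Fin.cases ?_ (fun i => ?_) i
    · simp only [sum_Psi, Prod.smul_fst, Prod.smul_snd, Pi.smul_apply, Fin.cons_zero,
        smul_eq_mul, TrivSqZeroExt.fst_mul, Ru_smul_F2, RingHom.id_apply, Finset.mul_sum, mul_add]
    · simp

theorem Psi_cons {α β : ℕ} (a : F2) (x : (Fin α → F2) × (Fin β → Ru))
    (h : α + 2 * β + 1 = (α + 1) + 2 * β) :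
    Psi ((Fin.cons a x.1 : Fin (α + 1) → F2), x.2) ∘ Fin.cast h = Fin.cons a (Psi x) := by
  simp only [Psi, Fin.append_cons]
  rfl

/-- Extending a `ℤ₂ℤ₂[u]`-linear code `C = Ψ(𝒞)` by an overall parity-check bit (placed
among the binary coordinates, here prepended) yields `Ψ(𝒞')` for the `ℤ₂ℤ₂[u]`-additive
code `𝒞' = {((Σᵢ Ψ(x)ᵢ, x₁, …, x_α) | x') : (x | x') ∈ 𝒞} ⊆ 𝔽₂^(α+1) × R^β`. -/
theorem extended_code_z2z2u (α β : ℕ)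
    (𝒞 : Submodule Ru ((Fin α → F2) × (Fin β → Ru))) :
    (∃ M : Submodule Ru ((Fin (α + 1) → F2) × (Fin β → Ru)),
      (M : Set ((Fin (α + 1) → F2) × (Fin β → Ru))) =
        (fun x : (Fin α → F2) × (Fin β → Ru) =>
            ((Fin.cons (∑ i, Psi x i) x.1 : Fin (α + 1) → F2), x.2)) ''
          (𝒞 : Set ((Fin α → F2) × (Fin β → Ru)))) ∧
    (fun c : Fin (α + 2 * β) → F2 => (Fin.cons (∑ i, c i) c : Fin (α + 2 * β + 1) → F2)) ''
        (Psi '' (𝒞 : Set ((Fin α → F2) × (Fin β → Ru)))) =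
      (fun p : (Fin (α + 1) → F2) × (Fin β → Ru) =>
          Psi p ∘ Fin.cast (by omega : α + 2 * β + 1 = (α + 1) + 2 * β)) ''
        ((fun x : (Fin α → F2) × (Fin β → Ru) =>
            ((Fin.cons (∑ i, Psi x i) x.1 : Fin (α + 1) → F2), x.2)) ''
          (𝒞 : Set ((Fin α → F2) × (Fin β → Ru)))) := by
  refine ⟨⟨𝒞.map (parityExtend α β), rfl⟩, ?_⟩
  simp only [Set.image_image, Psi_cons]
end

section
/- For all x, y ∈ 𝔽₂^α × ℤ₄^β, the identity Φ(x) + Φ(y) = Φ(x + y) + Φ(2(x⋆y)) holds in 𝔽₂^(α+2β), where x⋆y denotes the coordinatewise product (computed in 𝔽₂ on the first α coordinates and in ℤ₄ on the last β coordinates). -/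
/-- The ring `ℤ₄`. -/
abbrev Z4 : Type := ZMod 4

/-- The Gray map `φ : ℤ₄ → 𝔽₂²`, `φ(0)=(0,0), φ(1)=(0,1), φ(2)=(1,1), φ(3)=(1,0)`. -/
def phi4 (a : Z4) : F2 × F2 :=
  match a.val with
  | 0 => (0, 0)
  | 1 => (0, 1)
  | 2 => (1, 1)
  | _ => (1, 0)

/-- Coordinatewise extension `φ : ℤ₄^β → 𝔽₂^(2β)` of the Gray map. -/
def phiVec {β : ℕ} (x : Fin β → Z4) : Fin (2 * β) → F2 := fun k =>
  if k.val % 2 = 0 then (phi4 (x ⟨k.val / 2, by have := k.isLt; omega⟩)).1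
  else (phi4 (x ⟨k.val / 2, by have := k.isLt; omega⟩)).2

/-- The map `Φ : 𝔽₂^α × ℤ₄^β → 𝔽₂^(α+2β)`, `Φ(x | x') = (x | φ(x'))`. -/
def Phi {α β : ℕ} (p : (Fin α → F2) × (Fin β → Z4)) : Fin (α + 2 * β) → F2 :=
  Fin.append p.1 (phiVec p.2)

/-- The coordinatewise product `x⋆y` on `𝔽₂^α × ℤ₄^β` (computed in `𝔽₂` on the first `α`
coordinates and in `ℤ₄` on the last `β` coordinates). -/
def starProd {α β : ℕ} (x y : (Fin α → F2) × (Fin β → Z4)) :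
    (Fin α → F2) × (Fin β → Z4) :=
  (fun i => x.1 i * y.1 i, fun j => x.2 j * y.2 j)

/-- The Gray map identity `φ(a) + φ(b) = φ(a + b) + φ(2ab)` on `ℤ₄`. -/
theorem phi4_add_phi4 (a b : Z4) : phi4 a + phi4 b = phi4 (a + b) + phi4 (2 • (a * b)) := by
  revert a b
  decide

theorem phiVec_add_phiVec {β : ℕ} (x y : Fin β → Z4) :
    phiVec x + phiVec y = phiVec (x + y) + phiVec (2 • (x * y)) := by
  funext k
  simp only [phiVec, Pi.add_apply, Pi.smul_apply, Pi.mul_apply]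
  split_ifs
  · exact congrArg Prod.fst (phi4_add_phi4 _ _)
  · exact congrArg Prod.snd (phi4_add_phi4 _ _)

/-- For all `x, y ∈ 𝔽₂^α × ℤ₄^β`, `Φ(x) + Φ(y) = Φ(x + y) + Φ(2(x⋆y))` holds in
`𝔽₂^(α+2β)`. Here `2·` acts as multiplication by `2` in `ℤ₄` on the last `β`
coordinates and as the zero map on the first `α` binary coordinates. -/
theorem gray_map_sum_identity (α β : ℕ) (x y : (Fin α → F2) × (Fin β → Z4)) :
    Phi x + Phi y = Phi (x + y) + Phi (2 • starProd x y) := by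
  funext k
  refine Fin.addCases (fun i => ?_) (fun j => ?_) k
  · have h : (2 : ℕ) • (x.1 i * y.1 i) = 0 := by
      rw [two_nsmul, CharTwo.add_self_eq_zero]
    simp only [Phi, Pi.add_apply, Fin.append_left, Prod.fst_add, Prod.smul_fst, Pi.smul_apply,
      starProd, h, add_zero]
  · simp only [Phi, Pi.add_apply, Fin.append_right]
    exact congrFun (phiVec_add_phiVec x.2 y.2) j
end

section
/- Let 𝒞 be a ℤ₂ℤ₄-additive code, i.e., an additive subgroup of 𝔽₂^α × ℤ₄^β. Then the binary image Φ(𝒞) is an 𝔽₂-linear subspace of 𝔽₂^(α+2β) if and only if 2(x⋆y) ∈ 𝒞 for all x, y ∈ 𝒞, where x⋆y denotes the coordinatewise product (computed in 𝔽₂ on the first α coordinates and in ℤ₄ on the last β coordinates). -/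
theorem phi4_injective : Function.Injective phi4 := by decide

theorem phi4_add (a b : Z4) : phi4 (a + b + 2 • (a * b)) = phi4 a + phi4 b := by
  revert a b
  decide

theorem phiVec_injective {β : ℕ} : Function.Injective (phiVec (β := β)) := by
  intro x y h
  funext j
  apply phi4_injective
  apply Prod.ext
  · have h₀ := congrFun h ⟨2 * j.val, by omega⟩
    simpa [phiVec] using h₀
  · have h₁ := congrFun h ⟨2 * j.val + 1, by omega⟩
    have hdiv : (2 * j.val + 1) / 2 = j.val := by omega
    have hmod : (2 * j.val + 1) % 2 = 1 := by omega
    simpa [phiVec, hdiv, hmod] using h₁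

theorem phiVec_add {β : ℕ} (x y : Fin β → Z4) :
    phiVec (x + y + 2 • (x * y)) = phiVec x + phiVec y := by
  funext k
  have h := phi4_add (x ⟨k.val / 2, by omega⟩) (y ⟨k.val / 2, by omega⟩)
  by_cases hk : k.val % 2 = 0
  · simpa [phiVec, hk] using congrArg Prod.fst h
  · simpa [phiVec, hk] using congrArg Prod.snd h

theorem Phi_injective {α β : ℕ} : Function.Injective (Phi (α := α) (β := β)) := by
  intro p q h
  apply Prod.ext
  · funext i
    simpa [Phi] using congrFun h (Fin.castAdd (2 * β) i)
  · apply phiVec_injective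
    funext k
    simpa [Phi] using congrFun h (Fin.natAdd α k)

/-- The Gray map turns addition, corrected by twice the product, into binary addition. -/
theorem Phi_add {α β : ℕ} (x y : (Fin α → F2) × (Fin β → Z4)) :
    Phi (x + y + 2 • starProd x y) = Phi x + Phi y := by
  have h₂ : (x + y + 2 • starProd x y).2 = x.2 + y.2 + 2 • (x.2 * y.2) := rfl
  have h₁ : (x + y + 2 • starProd x y).1 = x.1 + y.1 := by
    funext i
    change x.1 i + y.1 i + 2 • (x.1 i * y.1 i) = x.1 i + y.1 i
    rw [CharTwo.two_nsmul, add_zero]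
  unfold Phi
  rw [h₁, h₂, phiVec_add]
  funext k
  refine Fin.addCases (fun i => ?_) (fun j => ?_) k <;> simp

theorem Phi_zero {α β : ℕ} : Phi (0 : (Fin α → F2) × (Fin β → Z4)) = 0 := by
  have hstar : starProd (0 : (Fin α → F2) × (Fin β → Z4)) 0 = 0 := by
    ext <;> simp [starProd]
  have h := Phi_add (0 : (Fin α → F2) × (Fin β → Z4)) 0
  simpa [hstar] using h

/-- Let `𝒞` be a `ℤ₂ℤ₄`-additive code, i.e. an additive subgroup of `𝔽₂^α × ℤ₄^β`. Then
the binary image `Φ(𝒞)` is an `𝔽₂`-linear subspace of `𝔽₂^(α+2β)` if and only if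
`2(x⋆y) ∈ 𝒞` for all `x, y ∈ 𝒞`. -/
theorem phi_image_linear_iff (α β : ℕ)
    (𝒞 : AddSubgroup ((Fin α → F2) × (Fin β → Z4))) :
    (∃ C : Submodule F2 (Fin (α + 2 * β) → F2),
      (C : Set (Fin (α + 2 * β) → F2)) = Phi '' (𝒞 : Set ((Fin α → F2) × (Fin β → Z4)))) ↔
    (∀ x ∈ 𝒞, ∀ y ∈ 𝒞, 2 • starProd x y ∈ 𝒞) := by
  constructor
  · rintro ⟨C, hC⟩ x hx y hy
    have hmem : ∀ z ∈ 𝒞, Phi z ∈ C := fun z hz => by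
      rw [← SetLike.mem_coe, hC]
      exact ⟨z, hz, rfl⟩
    have hsum : Phi x + Phi y ∈ (C : Set (Fin (α + 2 * β) → F2)) :=
      C.add_mem (hmem x hx) (hmem y hy)
    rw [hC, ← Phi_add] at hsum
    rw [Phi_injective.mem_set_image] at hsum
    exact (𝒞.add_mem_cancel_left (𝒞.add_mem hx hy)).1 hsum
  · intro h
    refine ⟨AddSubgroup.toZModSubmodule 2
      { carrier := Phi '' (𝒞 : Set ((Fin α → F2) × (Fin β → Z4)))
        zero_mem' := ⟨0, 𝒞.zero_mem, Phi_zero⟩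
        add_mem' := ?_
        neg_mem' := ?_ }, rfl⟩
    · rintro _ _ ⟨x, hx, rfl⟩ ⟨y, hy, rfl⟩
      exact ⟨_, 𝒞.add_mem (𝒞.add_mem hx hy) (h x hx y hy), Phi_add x y⟩
    · rintro _ ⟨x, hx, rfl⟩
      refine ⟨x, hx, ?_⟩
      funext k
      exact (ZMod.neg_eq_self_mod_two _).symm
end

section
/- Let 𝒞 ⊆ 𝔽₂^α × ℤ₄^β be a ℤ₂ℤ₄-additive code such that the binary image Φ(𝒞) is an 𝔽₂-linear subspace of 𝔽₂^(α+2β). Then 𝒞' = θ(𝒞) ⊆ 𝔽₂^α × R^β is a ℤ₂ℤ₂[u]-additive code, i.e., an R-submodule of 𝔽₂^α × R^β. -/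
/-- The map `ϑ : ℤ₄ → R`, `ϑ(0)=0, ϑ(1)=1, ϑ(2)=u, ϑ(3)=1+u`. -/
def vartheta (a : Z4) : Ru :=
  match a.val with
  | 0 => 0
  | 1 => 1
  | 2 => DualNumber.eps
  | _ => 1 + DualNumber.eps

/-- The coordinatewise extension `θ : 𝔽₂^α × ℤ₄^β → 𝔽₂^α × R^β` of `ϑ`, acting as the
identity on the first `α` coordinates. -/
def theta {α β : ℕ} (p : (Fin α → F2) × (Fin β → Z4)) : (Fin α → F2) × (Fin β → Ru) :=
  (p.1, fun j => vartheta (p.2 j))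

/-- The additive isomorphism `𝔽₂² → R` that turns the Gray map into `ϑ`. -/
def grayToDual : F2 × F2 →+ Ru where
  toFun v := (v.1 + v.2, v.1)
  map_zero' := rfl
  map_add' v w := by
    refine TrivSqZeroExt.ext ?_ rfl
    change v.1 + w.1 + (v.2 + w.2) = v.1 + v.2 + (w.1 + w.2)
    ring

theorem grayToDual_phi4 (a : Z4) : grayToDual (phi4 a) = vartheta a := by
  fin_cases a <;> rfl

/-- The additive map `𝔽₂^(α+2β) → 𝔽₂^α × R^β` that turns `Φ` into `θ`. -/
def binaryToDual (α β : ℕ) : (Fin (α + 2 * β) → F2) →+ (Fin α → F2) × (Fin β → Ru) where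
  toFun x := (fun i => x (Fin.castAdd (2 * β) i), fun j =>
    grayToDual (x (Fin.natAdd α ⟨2 * j.val, by omega⟩), x (Fin.natAdd α ⟨2 * j.val + 1, by omega⟩)))
  map_zero' := rfl
  map_add' x y := Prod.ext rfl (funext fun _ => grayToDual.map_add (_, _) (_, _))

theorem binaryToDual_Phi {α β : ℕ} (p : (Fin α → F2) × (Fin β → Z4)) :
    binaryToDual α β (Phi p) = theta p := by
  refine Prod.ext (funext fun i => Fin.append_left _ _ i) (funext fun j => ?_)
  have h : (2 * j.val + 1) / 2 = j.val := by omega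
  change grayToDual (Fin.append p.1 (phiVec p.2) (Fin.natAdd α _),
    Fin.append p.1 (phiVec p.2) (Fin.natAdd α _)) = vartheta (p.2 j)
  rw [Fin.append_right, Fin.append_right]
  simp [phiVec, h, Nat.add_mod, grayToDual_phi4]

theorem vartheta_two_nsmul (a : Z4) : vartheta (2 • a) = DualNumber.eps * vartheta a := by
  fin_cases a <;> rfl

theorem theta_two_nsmul {α β : ℕ} (p : (Fin α → F2) × (Fin β → Z4)) :
    theta (2 • p) = (DualNumber.eps : Ru) • theta p := by
  refine Prod.ext (funext fun i => ?_) (funext fun j => vartheta_two_nsmul (p.2 j))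
  change 2 • p.1 i = (0 : F2) * p.1 i
  rw [zero_mul, two_nsmul, CharTwo.add_self_eq_zero]

theorem dualNumber_F2_cases (r : Ru) :
    r = 0 ∨ r = 1 ∨ r = DualNumber.eps ∨ r = 1 + DualNumber.eps := by
  obtain ⟨a, b⟩ := r
  fin_cases a <;> fin_cases b
  exacts [.inl rfl, .inr (.inr (.inl rfl)), .inr (.inl rfl), .inr (.inr (.inr rfl))]

/-- Let `𝒞 ⊆ 𝔽₂^α × ℤ₄^β` be a `ℤ₂ℤ₄`-additive code such that `Φ(𝒞)` is an `𝔽₂`-linear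
subspace of `𝔽₂^(α+2β)`. Then `𝒞' = θ(𝒞) ⊆ 𝔽₂^α × R^β` is a `ℤ₂ℤ₂[u]`-additive code,
i.e. an `R`-submodule of `𝔽₂^α × R^β`. -/
theorem theta_image_z2z2u (α β : ℕ)
    (𝒞 : AddSubgroup ((Fin α → F2) × (Fin β → Z4)))
    (hlin : ∃ C : Submodule F2 (Fin (α + 2 * β) → F2),
      (C : Set (Fin (α + 2 * β) → F2)) = Phi '' (𝒞 : Set ((Fin α → F2) × (Fin β → Z4)))) :
    ∃ M : Submodule Ru ((Fin α → F2) × (Fin β → Ru)),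
      (M : Set ((Fin α → F2) × (Fin β → Ru))) =
        theta '' (𝒞 : Set ((Fin α → F2) × (Fin β → Z4))) := by
  obtain ⟨C, hC⟩ := hlin
  have himage : (C.toAddSubgroup.map (binaryToDual α β) : Set ((Fin α → F2) × (Fin β → Ru))) =
      theta '' (𝒞 : Set ((Fin α → F2) × (Fin β → Z4))) := by
    rw [AddSubgroup.coe_map, Submodule.coe_toAddSubgroup, hC, Set.image_image]
    simp only [binaryToDual_Phi]
  refine ⟨{ (C.toAddSubgroup.map (binaryToDual α β)).toAddSubmonoid with
    smul_mem' := fun r z hz => ?_ }, himage⟩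
  change r • z ∈ C.toAddSubgroup.map (binaryToDual α β)
  change z ∈ C.toAddSubgroup.map (binaryToDual α β) at hz
  have heps : (DualNumber.eps : Ru) • z ∈ C.toAddSubgroup.map (binaryToDual α β) := by
    rw [← SetLike.mem_coe, himage] at hz ⊢
    obtain ⟨p, hp, rfl⟩ := hz
    exact ⟨2 • p, 𝒞.nsmul_mem hp 2, theta_two_nsmul p⟩
  obtain rfl | rfl | rfl | rfl := dualNumber_F2_cases r
  · rw [zero_smul]
    exact zero_mem _
  · rwa [one_smul]
  · exact heps
  · rw [add_smul, one_smul]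
    exact add_mem hz heps
end

section
/- Let 𝒞 ⊆ 𝔽₂^α × ℤ₄^β be a ℤ₂ℤ₄-additive code with β > 0 and let C = Φ(𝒞). Let σ be the permutation of the α+2β coordinates fixing the first α coordinates and transposing coordinates α+2i−1 and α+2i for each i = 1, …, β. Then σ(Φ(x)) = Φ(3·x) for every x ∈ 𝒞 (where 3·x = x + x + x); in particular σ is an involution belonging to Aut(C), and hence Aut(C) has even order. -/
lemma phi4_three_nsmul (a : Z4) : phi4 (3 • a) = (phi4 a).swap := by
  revert a
  decide

lemma Phi_apply {α β : ℕ} (p : (Fin α → F2) × (Fin β → Z4)) (k : Fin (α + 2 * β)) :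
    Phi p k = if h : k.val < α then p.1 ⟨k.val, h⟩ else phiVec p.2 ⟨k.val - α, by omega⟩ := by
  refine Fin.addCases (fun i => ?_) (fun i => ?_) k <;> simp [Phi]

lemma sigmaPerm_inv_apply (α β : ℕ) (i : Fin (α + 2 * β)) :
    (sigmaPerm α β)⁻¹ i = sigmaFun α β i := rfl

/-- Coordinate swapping in each Gray pair is multiplication by `3`. -/
lemma Phi_comp_sigmaPerm_inv {α β : ℕ} (x : (Fin α → F2) × (Fin β → Z4)) :
    (fun i => Phi x ((sigmaPerm α β)⁻¹ i)) = Phi (3 • x) := by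
  funext i
  rw [sigmaPerm_inv_apply, Phi_apply, Phi_apply]
  by_cases h1 : i.val < α
  · have key : ∀ a : F2, a = 3 • a := by decide
    simpa [sigmaFun, h1] using key _
  by_cases h2 : (i.val - α) % 2 = 0
  · have e1 : ¬ i.val + 1 < α := by omega
    have e2 : (i.val + 1 - α) % 2 = 1 := by omega
    have e3 : (i.val + 1 - α) / 2 = (i.val - α) / 2 := by omega
    simp only [sigmaFun, h1, h2, e1, e2, e3, phiVec, dif_pos, dif_neg, if_pos, not_false_eq_true,
      one_ne_zero, if_false, Prod.smul_snd, Pi.smul_apply, phi4_three_nsmul, Prod.fst_swap]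
  · have e1 : ¬ i.val - 1 < α := by omega
    have e2 : (i.val - 1 - α) % 2 = 0 := by omega
    have e3 : (i.val - 1 - α) / 2 = (i.val - α) / 2 := by omega
    simp only [sigmaFun, h1, h2, e1, e2, e3, phiVec, dif_neg, if_pos, not_false_eq_true,
      if_false, Prod.smul_snd, Pi.smul_apply, phi4_three_nsmul, Prod.snd_swap]

lemma sigmaPerm_ne_refl (α : ℕ) {β : ℕ} (hβ : 0 < β) :
    sigmaPerm α β ≠ Equiv.refl (Fin (α + 2 * β)) := by
  intro h
  have h' : sigmaFun α β ⟨α, by omega⟩ = ⟨α, by omega⟩ := DFunLike.congr_fun h _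
  simp [sigmaFun] at h'

lemma image_sigmaPerm {α β : ℕ} (𝒞 : AddSubgroup ((Fin α → F2) × (Fin β → Z4))) :
    (fun c : Fin (α + 2 * β) → F2 => fun i => c ((sigmaPerm α β)⁻¹ i)) ''
        (Phi '' (𝒞 : Set ((Fin α → F2) × (Fin β → Z4)))) =
      Phi '' (𝒞 : Set ((Fin α → F2) × (Fin β → Z4))) := by
  rw [Set.image_image]
  simp only [Phi_comp_sigmaPerm_inv]
  ext c
  constructor
  · rintro ⟨x, hx, rfl⟩
    exact ⟨3 • x, 𝒞.nsmul_mem hx 3, rfl⟩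
  · rintro ⟨x, hx, rfl⟩
    have key1 : ∀ a : F2, 3 • 3 • a = a := by decide
    have key2 : ∀ a : Z4, 3 • 3 • a = a := by decide
    exact ⟨3 • x, 𝒞.nsmul_mem hx 3, congrArg Phi
      (Prod.ext (funext fun _ => key1 _) (funext fun _ => key2 _))⟩

/-- A finite type with a fixed-point-free involution has even cardinality. -/
lemma Function.Involutive.even_natCard {T : Type*} [Finite T] {f : T → T}
    (hf : Function.Involutive f) (hne : ∀ t, f t ≠ t) : Even (Nat.card T) := by
  classical
  have := Fintype.ofFinite T
  have : Fact (Nat.Prime 2) := ⟨Nat.prime_two⟩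
  have h := Equiv.Perm.card_fixedPoints_modEq (f := f) (p := 2) (n := 1)
    (by funext t; exact hf t)
  have : IsEmpty (Function.fixedPoints f) := ⟨fun t => hne t.1 t.2⟩
  rw [Fintype.card_eq_zero (α := Function.fixedPoints f)] at h
  rw [Nat.card_eq_fintype_card]
  exact even_iff_two_dvd.mpr (Nat.modEq_zero_iff_dvd.mp h)

/-- The coordinate permutations preserving `S` are even in number if an involution preserves `S`. -/
lemma even_card_perm_preserving {n : ℕ} {A : Type*} (S : Set (Fin n → A)) {σ : Equiv.Perm (Fin n)}
    (hinv : ∀ i, σ (σ i) = i) (hne : σ ≠ 1)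
    (hS : (fun c : Fin n → A => fun i => c (σ⁻¹ i)) '' S = S) :
    Even (Nat.card {τ : Equiv.Perm (Fin n) //
      (fun c : Fin n → A => fun i => c (τ⁻¹ i)) '' S = S}) := by
  let f : {τ : Equiv.Perm (Fin n) // (fun c : Fin n → A => fun i => c (τ⁻¹ i)) '' S = S} →
      {τ : Equiv.Perm (Fin n) // (fun c : Fin n → A => fun i => c (τ⁻¹ i)) '' S = S} :=
    fun τ => ⟨σ * τ.1, by
      conv_rhs => rw [← hS, ← τ.2, Set.image_image]
      simp only [mul_inv_rev, Equiv.Perm.mul_apply]⟩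
  refine Function.Involutive.even_natCard (f := f) (fun τ => ?_) (fun τ h => ?_)
  · exact Subtype.ext (Equiv.ext fun i => hinv _)
  · exact hne (mul_eq_right.mp (congrArg Subtype.val h))

/-- Let `𝒞 ⊆ 𝔽₂^α × ℤ₄^β` be a `ℤ₂ℤ₄`-additive code with `β > 0` and `C = Φ(𝒞)`. Then
`σ(Φ(x)) = Φ(3·x)` for every `x ∈ 𝒞` (where `3·x = x + x + x`); in particular `σ` is an
involution belonging to `Aut(C)`, and hence `Aut(C)` has even order. -/
theorem z2z4_aut_even (α β : ℕ) (hβ : 0 < β)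
    (𝒞 : AddSubgroup ((Fin α → F2) × (Fin β → Z4))) :
    (∀ x ∈ 𝒞, (fun i => Phi x ((sigmaPerm α β)⁻¹ i)) = Phi (3 • x)) ∧
    (∀ i, sigmaPerm α β (sigmaPerm α β i) = i) ∧
    sigmaPerm α β ≠ Equiv.refl (Fin (α + 2 * β)) ∧
    (fun c : Fin (α + 2 * β) → F2 => fun i => c ((sigmaPerm α β)⁻¹ i)) ''
        (Phi '' (𝒞 : Set ((Fin α → F2) × (Fin β → Z4)))) =
      Phi '' (𝒞 : Set ((Fin α → F2) × (Fin β → Z4))) ∧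
    Even (Nat.card {τ : Equiv.Perm (Fin (α + 2 * β)) //
      (fun c : Fin (α + 2 * β) → F2 => fun i => c (τ⁻¹ i)) ''
          (Phi '' (𝒞 : Set ((Fin α → F2) × (Fin β → Z4)))) =
        Phi '' (𝒞 : Set ((Fin α → F2) × (Fin β → Z4)))}) := by
  have hinv : ∀ i, sigmaPerm α β (sigmaPerm α β i) = i := sigmaFun_involutive α β
  exact ⟨fun x _ => Phi_comp_sigmaPerm_inv x, hinv, sigmaPerm_ne_refl α hβ, image_sigmaPerm 𝒞,
    even_card_perm_preserving _ hinv (sigmaPerm_ne_refl α hβ) (image_sigmaPerm 𝒞)⟩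
end

section
/- Let 𝒟 ⊆ R⁴ be the R-submodule generated by x = (1,1,1,u) and y = (1,u,1,1), i.e., 𝒟 = {λx + μy : λ, μ ∈ R}. Then (u, 1+u, u, 1+u) ∉ 𝒟, although (u, 1+u, u, 1+u) = θ(θ⁻¹(x) + θ⁻¹(y)) where θ⁻¹(x) = (1,1,1,2) and θ⁻¹(y) = (1,2,1,1) in ℤ₄⁴; consequently θ⁻¹(𝒟) is not closed under addition and is therefore not an additive subgroup of ℤ₄⁴. -/
/-- The vector `x = (1,1,1,u) ∈ R⁴`. -/
def xGen : Fin 4 → Ru := ![1, 1, 1, DualNumber.eps]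

/-- The vector `y = (1,u,1,1) ∈ R⁴`. -/
def yGen : Fin 4 → Ru := ![1, DualNumber.eps, 1, 1]

/-- The `R`-submodule `𝒟 = {λx + μy : λ, μ ∈ R}` of `R⁴` generated by `x` and `y`
(under coordinatewise scalar multiplication). -/
def Dcode : Set (Fin 4 → Ru) :=
  {z | ∃ l m : Ru, z = fun j => l * xGen j + m * yGen j}

/-- The preimage `θ⁻¹(𝒟) ⊆ ℤ₄⁴` of `𝒟` under the coordinatewise extension `θ` of `ϑ`. -/
def DcodePre : Set (Fin 4 → Z4) := {z | (fun j => vartheta (z j)) ∈ Dcode}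

open DualNumber in
theorem not_mem_Dcode : (![ε, 1 + ε, ε, 1 + ε] : Fin 4 → Ru) ∉ Dcode := by
  rintro ⟨l, m, h⟩
  have h0 : (ε : Ru) = l * 1 + m * 1 := congrFun h 0
  have h1 : (1 + ε : Ru) = l * 1 + m * ε := congrFun h 1
  have h3 : (1 + ε : Ru) = l * ε + m * 1 := congrFun h 3
  have two_eq_zero : (2 : Ru) = 0 := by
    rw [← map_ofNat (algebraMap F2 Ru) 2, show (OfNat.ofNat 2 : F2) = 0 from rfl, map_zero]
  have eps_eq_zero : (ε : Ru) = 0 := by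
    linear_combination (1 + ε) * h0 - h1 - h3 - eps_mul_eps (R := F2) + (1 + ε) * two_eq_zero
  simpa using congrArg TrivSqZeroExt.snd eps_eq_zero

theorem vartheta_xGen : (fun j => vartheta ((![1, 1, 1, 2] : Fin 4 → Z4) j)) = xGen := by
  funext j; fin_cases j <;> rfl

theorem vartheta_yGen : (fun j => vartheta ((![1, 2, 1, 1] : Fin 4 → Z4) j)) = yGen := by
  funext j; fin_cases j <;> rfl

open DualNumber in
theorem vartheta_add :
    (fun j => vartheta (((![1, 1, 1, 2] + ![1, 2, 1, 1]) : Fin 4 → Z4) j)) =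
      (![ε, 1 + ε, ε, 1 + ε] : Fin 4 → Ru) := by
  funext j; fin_cases j <;> rfl

theorem DcodePre_not_add_closed : ¬ (∀ a ∈ DcodePre, ∀ b ∈ DcodePre, a + b ∈ DcodePre) := by
  intro h
  have hx : ![1, 1, 1, 2] ∈ DcodePre :=
    ⟨1, 0, by simpa using vartheta_xGen⟩
  have hy : ![1, 2, 1, 1] ∈ DcodePre :=
    ⟨0, 1, by simpa using vartheta_yGen⟩
  exact not_mem_Dcode (vartheta_add ▸ h _ hx _ hy)

/-- `(u, 1+u, u, 1+u) ∉ 𝒟`, although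
`(u, 1+u, u, 1+u) = θ(θ⁻¹(x) + θ⁻¹(y))` with `θ⁻¹(x) = (1,1,1,2)` and
`θ⁻¹(y) = (1,2,1,1)` in `ℤ₄⁴`; consequently `θ⁻¹(𝒟)` is not closed under addition and is
therefore not an additive subgroup of `ℤ₄⁴`. -/
theorem example_not_z2z4 :
    (![DualNumber.eps, 1 + DualNumber.eps, DualNumber.eps, 1 + DualNumber.eps] : Fin 4 → Ru)
      ∉ Dcode ∧
    (fun j => vartheta ((![1, 1, 1, 2] : Fin 4 → Z4) j)) = xGen ∧
    (fun j => vartheta ((![1, 2, 1, 1] : Fin 4 → Z4) j)) = yGen ∧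
    (fun j => vartheta (((![1, 1, 1, 2] + ![1, 2, 1, 1]) : Fin 4 → Z4) j)) =
      (![DualNumber.eps, 1 + DualNumber.eps, DualNumber.eps, 1 + DualNumber.eps] :
        Fin 4 → Ru) ∧
    ¬ (∀ a ∈ DcodePre, ∀ b ∈ DcodePre, a + b ∈ DcodePre) ∧
    ¬ (∃ G : AddSubgroup (Fin 4 → Z4), (G : Set (Fin 4 → Z4)) = DcodePre) := by
  refine ⟨not_mem_Dcode, vartheta_xGen, vartheta_yGen, vartheta_add, DcodePre_not_add_closed, ?_⟩
  rintro ⟨G, hG⟩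
  refine DcodePre_not_add_closed ?_
  rw [← hG]
  exact fun _ ha _ hb => G.add_mem ha hb
end
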